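/- Define h : ℂ → ℂ by h(z) = −((z+2)(z−2)³) / (3(z² + 2z − 2)²) wherever z² + 2z − 2 ≠ 0. Then h(−1) = 1, h(2) = 0, and for every z ∈ ℂ with z² + 2z − 2 ≠ 0 one has deriv h z = 0 if and only if z = −1 or z = 2. -/

import Mathlib

/-- The Belyi function h(z) = −(z+2)(z−2)³/(3(z²+2z−2)²) of Example 1. -/
noncomputable def belyiHalf : ℂ → ℂ :=
  fun z => -((z + 2) * (z - 2) ^ 3) / (3 * (z ^ 2 + 2 * z - 2) ^ 2)

theorem hasDerivAt_belyiHalf {z : ℂ} (hz : z ^ 2 + 2 * z - 2 ≠ 0) :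
    HasDerivAt belyiHalf
      (-(8 * ((z + 1) ^ 2 * (z - 2) ^ 2)) / (3 * (z ^ 2 + 2 * z - 2) ^ 3)) z := by
  have hid := hasDerivAt_id' z
  have hnum := ((hid.add_const 2).mul ((hid.sub_const 2).pow 3)).neg
  have hden := ((((hid.pow 2).add (hid.const_mul 2)).sub_const 2).pow 2).const_mul 3
  have hne : 3 * (z ^ 2 + 2 * z - 2) ^ 2 ≠ 0 := mul_ne_zero three_ne_zero (pow_ne_zero 2 hz)
  refine (hnum.div hden hne).congr_deriv ?_
  simp only [Pi.add_apply, Pi.mul_apply, Pi.neg_apply, Pi.pow_apply]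
  rw [div_eq_div_iff (pow_ne_zero 2 hne) (mul_ne_zero three_ne_zero (pow_ne_zero 3 hz))]
  push_cast
  ring

/-- h(−1) = 1, h(2) = 0, and the finite critical points of h are exactly −1 and 2. -/
theorem belyiHalf_critical_points :
    belyiHalf (-1) = 1 ∧ belyiHalf 2 = 0 ∧
    ∀ z : ℂ, z ^ 2 + 2 * z - 2 ≠ 0 →
      (deriv belyiHalf z = 0 ↔ (z = -1 ∨ z = 2)) := by
  refine ⟨by norm_num [belyiHalf], by norm_num [belyiHalf], fun z hz => ?_⟩
  rw [(hasDerivAt_belyiHalf hz).deriv]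
  simp [hz, sub_eq_zero, add_eq_zero_iff_eq_neg]
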